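/- Let b₁ : ℝ₊ × ℝ^{m-1} → ℝ be non-decreasing in each argument, and let D := {(t,x) ∈ ℝ₊ × ℝ^m : x₁ ≤ b₁(t, x_2,…,x_m)}. If D is a closed subset of ℝ₊ × ℝ^m, then the monotone limit b₁^{0+}(t, z_{-1}) := lim_{ε↓0} [ b₁(t+ε, z_2+ε,…,z_m+ε) + ε ] equals b₁(t, z_{-1}) for all (t, z_{-1}). -/

import Mathlib

open Set Filter Topology

/-- If `b₁` is non-decreasing in each argument and the sub-graph set
`D = {(t,x) ∈ ℝ₊ × ℝᵐ : x₁ ≤ b₁(t, x₋₁)}` is closed, then the monotone limit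
`b₁^{0+}(t,z) = lim_{ε↓0} (b₁(t+ε, z+ε) + ε)` equals `b₁(t,z)`. Here the spatial
variable is split as `(x₁, xr)` with `xr : Fin k → ℝ` the remaining coordinates. -/
theorem stmt_4 {k : ℕ} (b₁ : ℝ → (Fin k → ℝ) → ℝ)
    (hmt : ∀ z, Monotone fun t => b₁ t z)
    (hmx : ∀ t, Monotone (b₁ t))
    (hD : IsClosed {p : ℝ × ℝ × (Fin k → ℝ) | 0 ≤ p.1 ∧ p.2.1 ≤ b₁ p.1 p.2.2})
    (t : ℝ) (ht : 0 ≤ t) (z : Fin k → ℝ) :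
    Tendsto (fun ε : ℝ => b₁ (t + ε) (fun i => z i + ε) + ε)
      (nhdsWithin 0 (Ioi 0)) (nhds (b₁ t z)) := by
  rw [tendsto_order]
  constructor
  · intro a ha
    filter_upwards [self_mem_nhdsWithin] with ε hε
    have hε' : (0 : ℝ) < ε := hε
    have h1 : b₁ t z ≤ b₁ (t + ε) z := hmt z (by linarith)
    have h2 : b₁ (t + ε) z ≤ b₁ (t + ε) (fun i => z i + ε) :=
      hmx (t + ε) (fun i => by simpa using hε'.le)
    linarith
  · intro a ha
    obtain ⟨c, hc1, hc2⟩ := exists_between ha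
    have hcont : Continuous (fun ε : ℝ =>
        ((t + ε, c, fun i => z i + ε) : ℝ × ℝ × (Fin k → ℝ))) := by fun_prop
    have hopen := (hD.preimage hcont).isOpen_compl
    have hmem := hopen.mem_nhds (x := (0 : ℝ)) (by
      simp only [mem_compl_iff, mem_preimage, mem_setOf_eq, add_zero]
      rintro ⟨-, h⟩
      exact absurd h (not_le.mpr hc1))
    have hlt : Iio (a - c) ∈ 𝓝 (0 : ℝ) := Iio_mem_nhds (by linarith)
    filter_upwards [self_mem_nhdsWithin, mem_nhdsWithin_of_mem_nhds hmem,
      mem_nhdsWithin_of_mem_nhds hlt] with ε hε h1 h2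
    have hε' : (0 : ℝ) < ε := hε
    have h2' : ε < a - c := h2
    have h3 : b₁ (t + ε) (fun i => z i + ε) < c := by
      by_contra hcon
      exact h1 ⟨by change 0 ≤ t + ε; linarith, not_lt.mp hcon⟩
    linarith
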